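/- Let ℂ² have basis e_{-1}, e_1, P° = Σ_{i,j∈{-1,1}} E_{ij}⊗E_{ji}, R°(u) = I − P°/u, and for an operator R on ℂ²⊗ℂ² let R_{ab} denote R acting on tensor factors a,b of (ℂ²)^{⊗4}. Define R_V(u) = ¼ R°₁₂(−1) R°₃₄(−1) R°₁₄(2u−1) R°₁₃(2u) R°₂₄(2u) R°₂₃(2u+1) ∈ End((ℂ²)^{⊗4}). Let ι: ℂ³ → ℂ²⊗ℂ² be the linear map sending the standard basis w_{-1}, w_0, w_1 of ℂ³ to v_{-1} = e_{-1}⊗e_{-1}, v_0 = (1/√2)(e_{-1}⊗e_1 + e_1⊗e_{-1}), v_1 = −e_1⊗e_1, and index the basis of ℂ³ by {-1,0,1}. On ℂ³⊗ℂ³ set P_V = Σ_{i,j∈{-1,0,1}} E_{ij}⊗E_{ji} and Q_V = Σ_{i,j∈{-1,0,1}} E_{ij}⊗E_{-i,-j}. Then, as an identity of rational functions in u, R_V(u)∘(ι⊗ι) = (ι⊗ι)∘[((2u−1)/(2u+1))·(I − P_V/u + Q_V/(u−1/2))], where ι⊗ι: ℂ³⊗ℂ³ → (ℂ²⊗ℂ²)⊗(ℂ²⊗ℂ²)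 identifies the first two legs of (ℂ²)^{⊗4} with the image of the first ℂ³ factor and the last two legs with the image of the second. -/

import Mathlib

open Matrix Kronecker Finset

noncomputable section

/-- The index set `I_N` as a subtype of `ℤ` determined by a finite set `S ⊆ ℤ`. -/
abbrev Idx (S : Finset ℤ) : Type := {i : ℤ // i ∈ S}

/-- The matrix unit `E_{ab}` of `End(ℂ^N)` (zero if `a` or `b` is not in the index set). -/
def Emat (S : Finset ℤ) (a b : ℤ) : Matrix (Idx S) (Idx S) ℂ :=
  fun p q => if ((p : ℤ) = a ∧ (q : ℤ) = b) then 1 else 0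

/-- The permutation operator `P = Σ_{i,j} E_{ij} ⊗ E_{ji}` on `ℂ^N ⊗ ℂ^N`. -/
def Pmat (S : Finset ℤ) : Matrix (Idx S × Idx S) (Idx S × Idx S) ℂ :=
  ∑ i ∈ S, ∑ j ∈ S, Emat S i j ⊗ₖ Emat S j i

/-- The operator `Q = Σ_{i,j} θ_{ij} E_{ij} ⊗ E_{-i,-j}` on `ℂ^N ⊗ ℂ^N`. -/
def Qmat (S : Finset ℤ) (θ : ℤ → ℤ → ℂ) : Matrix (Idx S × Idx S) (Idx S × Idx S) ℂ :=
  ∑ i ∈ S, ∑ j ∈ S, θ i j • (Emat S i j ⊗ₖ Emat S (-i) (-j))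

/-- The R-matrix `R(u) = I - P/u + Q/(u - κ)` of types B, C, D. -/
def Rmat (S : Finset ℤ) (θ : ℤ → ℤ → ℂ) (κ u : ℂ) :
    Matrix (Idx S × Idx S) (Idx S × Idx S) ℂ :=
  1 - u⁻¹ • Pmat S + (u - κ)⁻¹ • Qmat S θ

/-- `θ_{ij} = 1` (orthogonal case). -/
def θorth : ℤ → ℤ → ℂ := fun _ _ => 1

/-- `θ_{ij} = sign(i)·sign(j)` (symplectic case). -/
def θsymp : ℤ → ℤ → ℂ := fun i j =>
  (if 0 < i then (1 : ℂ) else -1) * (if 0 < j then (1 : ℂ) else -1)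

/-- The two-element index set `{-1, 1}` for `ℂ²`. -/
def S2 : Finset ℤ := {-1, 1}

abbrev V2 : Type := Idx S2

/-- Negation `i ↦ -i` on the index set `{-1, 1}`. -/
def nneg (p : V2) : V2 :=
  ⟨-(p : ℤ), by
    have h := p.2
    simp only [S2, Finset.mem_insert, Finset.mem_singleton] at h ⊢
    omega⟩

/-- The rational R-matrix `R°(u) = I - P°/u` of type A on `ℂ² ⊗ ℂ²`. -/
def Ro (u : ℂ) : Matrix (V2 × V2) (V2 × V2) ℂ := 1 - u⁻¹ • Pmat S2

/-- `sign(i)` for `i ∈ {-1, 1}`. -/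
def ssgn : V2 → ℂ := fun i => if 0 < (i : ℤ) then 1 else -1

/-- Partial transpose applied to the first tensor factor of `ℂ² ⊗ ℂ²`, for the transpose
`M ↦ Σ_{i,j} s(i) s(j) M_{ij} E_{-j,-i}` of `2 × 2` matrices (take `s ≡ 1` for `t₊` and
`s = sign` for `t₋`). -/
def pt1 (s : V2 → ℂ) (X : Matrix (V2 × V2) (V2 × V2) ℂ) :
    Matrix (V2 × V2) (V2 × V2) ℂ :=
  fun p q => s p.1 * s q.1 * X (nneg q.1, p.2) (nneg p.1, q.2)

/-- The fourfold tensor power `(ℂ² ⊗ ℂ²) ⊗ (ℂ² ⊗ ℂ²)` index type. -/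
abbrev Q4g : Type := (V2 × V2) × (V2 × V2)

/-- `R_{12}` on `(ℂ²)^{⊗4}`. -/
def G12 (M : Matrix (V2 × V2) (V2 × V2) ℂ) : Matrix Q4g Q4g ℂ :=
  fun p q => M (p.1.1, p.1.2) (q.1.1, q.1.2) * (if p.2 = q.2 then 1 else 0)

/-- `R_{13}` on `(ℂ²)^{⊗4}`. -/
def G13 (M : Matrix (V2 × V2) (V2 × V2) ℂ) : Matrix Q4g Q4g ℂ :=
  fun p q => M (p.1.1, p.2.1) (q.1.1, q.2.1) *
    (if (p.1.2, p.2.2) = (q.1.2, q.2.2) then 1 else 0)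

/-- `R_{14}` on `(ℂ²)^{⊗4}`. -/
def G14 (M : Matrix (V2 × V2) (V2 × V2) ℂ) : Matrix Q4g Q4g ℂ :=
  fun p q => M (p.1.1, p.2.2) (q.1.1, q.2.2) *
    (if (p.1.2, p.2.1) = (q.1.2, q.2.1) then 1 else 0)

/-- `R_{23}` on `(ℂ²)^{⊗4}`. -/
def G23 (M : Matrix (V2 × V2) (V2 × V2) ℂ) : Matrix Q4g Q4g ℂ :=
  fun p q => M (p.1.2, p.2.1) (q.1.2, q.2.1) *
    (if (p.1.1, p.2.2) = (q.1.1, q.2.2) then 1 else 0)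

/-- `R_{24}` on `(ℂ²)^{⊗4}`. -/
def G24 (M : Matrix (V2 × V2) (V2 × V2) ℂ) : Matrix Q4g Q4g ℂ :=
  fun p q => M (p.1.2, p.2.2) (q.1.2, q.2.2) *
    (if (p.1.1, p.2.1) = (q.1.1, q.2.1) then 1 else 0)

/-- `R_{34}` on `(ℂ²)^{⊗4}`. -/
def G34 (M : Matrix (V2 × V2) (V2 × V2) ℂ) : Matrix Q4g Q4g ℂ :=
  fun p q => M (p.2.1, p.2.2) (q.2.1, q.2.2) * (if p.1 = q.1 then 1 else 0)

/-- The three-element index set `{-1, 0, 1}` for `ℂ³`. -/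
def S3 : Finset ℤ := {-1, 0, 1}

abbrev V3 : Type := Idx S3

/-- The embedding `ι : ℂ³ → ℂ² ⊗ ℂ²` sending the standard basis `w₋₁, w₀, w₁` to
`v₋₁ = e₋₁⊗e₋₁`, `v₀ = (1/√2)(e₋₁⊗e₁ + e₁⊗e₋₁)`, `v₁ = -e₁⊗e₁`, as a matrix. -/
def iota : Matrix (V2 × V2) V3 ℂ := fun p w =>
  if (w : ℤ) = -1 then (if ((p.1 : ℤ) = -1 ∧ (p.2 : ℤ) = -1) then 1 else 0)
  else if (w : ℤ) = 0 then
    (if (((p.1 : ℤ) = -1 ∧ (p.2 : ℤ) = 1) ∨ ((p.1 : ℤ) = 1 ∧ (p.2 : ℤ) = -1)) then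
      ((Real.sqrt 2 : ℂ))⁻¹ else 0)
  else (if ((p.1 : ℤ) = 1 ∧ (p.2 : ℤ) = 1) then -1 else 0)

/-- The fused `so₃` R-matrix
`R_V(u) = ¼ R°₁₂(-1) R°₃₄(-1) R°₁₄(2u-1) R°₁₃(2u) R°₂₄(2u) R°₂₃(2u+1)`. -/
def RV (u : ℂ) : Matrix Q4g Q4g ℂ :=
  (4 : ℂ)⁻¹ • (G12 (Ro (-1)) * G34 (Ro (-1)) * G14 (Ro (2 * u - 1)) * G13 (Ro (2 * u)) *
    G24 (Ro (2 * u)) * G23 (Ro (2 * u + 1)))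

lemma Pmat_apply (S : Finset ℤ) (p q : Idx S × Idx S) :
    Pmat S p q = if q = p.swap then 1 else 0 := by
  obtain ⟨⟨a, ha⟩, ⟨b, hb⟩⟩ := p
  obtain ⟨⟨c, hc⟩, ⟨d, hd⟩⟩ := q
  simp only [Pmat, Matrix.sum_apply, kroneckerMap_apply, Emat, Prod.swap_prod_mk,
    Prod.mk.injEq, Subtype.mk.injEq]
  rw [Finset.sum_eq_single a, Finset.sum_eq_single b]
  · by_cases h : c = b <;> by_cases h' : d = a <;> simp [h, h']
  · intro j _ hj
    simp [hj.symm]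
  · exact fun h => absurd hb h
  · intro i _ hi
    simp [hi.symm]
  · exact fun h => absurd ha h

lemma Qmat_θorth_apply (S : Finset ℤ) (p q : Idx S × Idx S) :
    Qmat S θorth p q =
      if (p.2 : ℤ) = -(p.1 : ℤ) ∧ (q.2 : ℤ) = -(q.1 : ℤ) then 1 else 0 := by
  obtain ⟨⟨a, ha⟩, ⟨b, hb⟩⟩ := p
  obtain ⟨⟨c, hc⟩, ⟨d, hd⟩⟩ := q
  simp only [Qmat, θorth, one_smul, Matrix.sum_apply, kroneckerMap_apply, Emat]
  rw [Finset.sum_eq_single a, Finset.sum_eq_single c]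
  · by_cases h : b = -a <;> by_cases h' : d = -c <;> simp [h, h']
  · intro j _ hj
    simp [hj.symm]
  · exact fun h => absurd hc h
  · intro i _ hi
    simp [hi.symm]
  · exact fun h => absurd ha h

lemma Ro_apply (c : ℂ) (p q : V2 × V2) :
    Ro c p q = (if q = p then 1 else 0) - c⁻¹ * (if q = p.swap then 1 else 0) := by
  simp [Ro, Pmat_apply, Matrix.one_apply, eq_comm]

section RoMul

variable {κ : Type*} (c : ℂ) (X : Matrix Q4g κ ℂ) (a b d e : V2) (q : κ)

lemma G12_Ro_mul_apply : (G12 (Ro c) * X) ((a, b), (d, e)) q =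
    X ((a, b), (d, e)) q - c⁻¹ * X ((b, a), (d, e)) q := by
  simp [Matrix.mul_apply, G12, Ro_apply, Fintype.sum_prod_type, sub_mul, Finset.sum_sub_distrib]

lemma G34_Ro_mul_apply : (G34 (Ro c) * X) ((a, b), (d, e)) q =
    X ((a, b), (d, e)) q - c⁻¹ * X ((a, b), (e, d)) q := by
  simp [Matrix.mul_apply, G34, Ro_apply, Fintype.sum_prod_type, sub_mul, Finset.sum_sub_distrib,
    Finset.sum_ite_irrel]

lemma G14_Ro_mul_apply : (G14 (Ro c) * X) ((a, b), (d, e)) q =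
    X ((a, b), (d, e)) q - c⁻¹ * X ((e, b), (d, a)) q := by
  simp [Matrix.mul_apply, G14, Ro_apply, Fintype.sum_prod_type, sub_mul, Finset.sum_sub_distrib,
    ite_and, Finset.sum_ite_irrel]

lemma G13_Ro_mul_apply : (G13 (Ro c) * X) ((a, b), (d, e)) q =
    X ((a, b), (d, e)) q - c⁻¹ * X ((d, b), (a, e)) q := by
  simp [Matrix.mul_apply, G13, Ro_apply, Fintype.sum_prod_type, sub_mul, Finset.sum_sub_distrib,
    ite_and, Finset.sum_ite_irrel]

lemma G24_Ro_mul_apply : (G24 (Ro c) * X) ((a, b), (d, e)) q =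
    X ((a, b), (d, e)) q - c⁻¹ * X ((a, e), (d, b)) q := by
  simp [Matrix.mul_apply, G24, Ro_apply, Fintype.sum_prod_type, sub_mul, Finset.sum_sub_distrib,
    ite_and, Finset.sum_ite_irrel]

lemma G23_Ro_mul_apply : (G23 (Ro c) * X) ((a, b), (d, e)) q =
    X ((a, b), (d, e)) q - c⁻¹ * X ((a, d), (b, e)) q := by
  simp [Matrix.mul_apply, G23, Ro_apply, Fintype.sum_prod_type, sub_mul, Finset.sum_sub_distrib,
    ite_and, Finset.sum_ite_irrel]

end RoMul

/-- The basis index `-1` of `ℂ²`. -/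
def vneg : V2 := ⟨-1, by decide⟩

/-- The basis index `1` of `ℂ²`. -/
def vpos : V2 := ⟨1, by decide⟩

lemma eq_vneg_or_eq_vpos (a : V2) : a = vneg ∨ a = vpos := by
  have ha := a.2
  simp only [S2, Finset.mem_insert, Finset.mem_singleton] at ha
  exact ha.imp Subtype.ext Subtype.ext

/-- The invariant skew-symmetric form on `ℂ²`, as a function of basis indices. -/
def skewForm (a b : V2) : ℂ := (((b : ℤ) : ℂ) - ((a : ℤ) : ℂ)) / 2

/-- The invariant tensor of `S²(ℂ²) ⊗ S²(ℂ²)`. -/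
def invTensor (a b d e : V2) : ℂ :=
  -(skewForm a d * skewForm b e + skewForm a e * skewForm b d) / 2

/-- The invariant bilinear form on `S²(ℂ²)`. -/
def invForm (f g : V2 × V2 → ℂ) : ℂ :=
  2 * (f (vneg, vpos) * g (vneg, vpos)) - f (vneg, vneg) * g (vpos, vpos) -
    f (vpos, vpos) * g (vneg, vneg)

lemma RV_mul_apply_of_symm {κ : Type*} (u : ℂ) (hu0 : u ≠ 0) (h1 : 2 * u - 1 ≠ 0)
    (h2 : 2 * u + 1 ≠ 0) (X : Matrix Q4g κ ℂ) (q : κ) (f g : V2 × V2 → ℂ)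
    (hf : f (vpos, vneg) = f (vneg, vpos)) (hg : g (vpos, vneg) = g (vneg, vpos))
    (hX : ∀ p, X p q = f p.1 * g p.2) (a b d e : V2) :
    (RV u * X) ((a, b), (d, e)) q =
      (2 * u - 1) / (2 * u + 1) * (f (a, b) * g (d, e) - u⁻¹ * (f (d, e) * g (a, b)) +
        (u - 1 / 2)⁻¹ * (invTensor a b d e * invForm f g)) := by
  have h3 : (u - 1 / 2)⁻¹ = 2 * (2 * u - 1)⁻¹ := by
    have : u - 1 / 2 = (2 * u - 1) / 2 := by ring
    rw [this, inv_div, div_eq_mul_inv]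
  rw [h3]
  simp only [RV, Matrix.smul_mul, Matrix.mul_assoc, Matrix.smul_apply, smul_eq_mul, G12_Ro_mul_apply,
    G34_Ro_mul_apply, G14_Ro_mul_apply, G13_Ro_mul_apply, G24_Ro_mul_apply, G23_Ro_mul_apply, hX]
  rcases eq_vneg_or_eq_vpos a with rfl | rfl <;> rcases eq_vneg_or_eq_vpos b with rfl | rfl <;>
  rcases eq_vneg_or_eq_vpos d with rfl | rfl <;> rcases eq_vneg_or_eq_vpos e with rfl | rfl <;>
  simp only [hf, hg, invTensor, invForm, skewForm] <;>
  simp only [vneg, vpos] <;>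
  push_cast <;>
  field_simp <;>
  ring

/-- Negation `i ↦ -i` on the index set `{-1, 0, 1}`. -/
def wneg (w : V3) : V3 :=
  ⟨-(w : ℤ), by
    have h := w.2
    simp only [S3, Finset.mem_insert, Finset.mem_singleton] at h ⊢
    omega⟩

lemma univ_V3 : (Finset.univ : Finset V3) =
    {⟨-1, by decide⟩, ⟨0, by decide⟩, ⟨1, by decide⟩} := by
  decide

lemma V3_cases (w : V3) :
    w = ⟨-1, by decide⟩ ∨ w = ⟨0, by decide⟩ ∨ w = ⟨1, by decide⟩ := by
  have hw := w.2
  simp only [S3, Finset.mem_insert, Finset.mem_singleton] at hw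
  exact hw.imp Subtype.ext (Or.imp Subtype.ext Subtype.ext)

lemma inv_sqrt_two_mul_self : ((Real.sqrt 2 : ℝ) : ℂ)⁻¹ * ((Real.sqrt 2 : ℝ) : ℂ)⁻¹ = 1 / 2 := by
  rw [← mul_inv, ← Complex.ofReal_mul, Real.mul_self_sqrt (by norm_num)]
  norm_num

lemma iota_symm (w : V3) : iota (vpos, vneg) w = iota (vneg, vpos) w := by
  simp [iota, vneg, vpos]

lemma invForm_iota (w z : V3) :
    invForm (fun p => iota p w) (fun p => iota p z) =
      if (z : ℤ) = -(w : ℤ) then 1 else 0 := by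
  rcases V3_cases w with rfl | rfl | rfl <;> rcases V3_cases z with rfl | rfl | rfl <;>
  simp [invForm, iota, vneg, vpos, inv_sqrt_two_mul_self]

lemma sum_iota_mul_iota_wneg (a b d e : V2) :
    ∑ i : V3, iota (a, b) i * iota (d, e) (wneg i) = invTensor a b d e := by
  rw [univ_V3]
  rcases eq_vneg_or_eq_vpos a with rfl | rfl <;> rcases eq_vneg_or_eq_vpos b with rfl | rfl <;>
  rcases eq_vneg_or_eq_vpos d with rfl | rfl <;> rcases eq_vneg_or_eq_vpos e with rfl | rfl <;>
  norm_num [invTensor, skewForm, iota, vneg, vpos, wneg, inv_sqrt_two_mul_self]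

lemma mul_Pmat_apply {κ : Type*} (S : Finset ℤ) (K : Matrix κ (Idx S × Idx S) ℂ) (p : κ)
    (q : Idx S × Idx S) : (K * Pmat S) p q = K p q.swap := by
  simp [Matrix.mul_apply, Pmat_apply, ← Prod.swap_eq_iff_eq_swap]

lemma mul_Qmat_apply {κ : Type*} (K : Matrix κ (V3 × V3) ℂ) (p : κ) (w z : V3) :
    (K * Qmat S3 θorth) p (w, z) =
      (∑ i, K p (i, wneg i)) * if (z : ℤ) = -(w : ℤ) then 1 else 0 := by
  have h (i j : V3) : (j : ℤ) = -(i : ℤ) ↔ j = wneg i := by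
    simp [wneg, Subtype.ext_iff]
  by_cases hzw : (z : ℤ) = -(w : ℤ) <;>
    simp [Matrix.mul_apply, Qmat_θorth_apply, Fintype.sum_prod_type, hzw, h]

/-- the fused fourfold R-matrix `R_V(u)` restricted along `ι ⊗ ι` equals the
`so₃` R-matrix: `R_V(u) ∘ (ι⊗ι) = (ι⊗ι) ∘ [((2u-1)/(2u+1))·(I - P_V/u + Q_V/(u-1/2))]`. -/
theorem RV_is_so3_R_matrix (u : ℂ) (hu0 : u ≠ 0) (h1 : 2 * u - 1 ≠ 0) (h2 : 2 * u + 1 ≠ 0) :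
    RV u * (iota ⊗ₖ iota) =
      (iota ⊗ₖ iota) *
        (((2 * u - 1) / (2 * u + 1)) •
          ((1 : Matrix (V3 × V3) (V3 × V3) ℂ) - u⁻¹ • Pmat S3 +
            (u - 1 / 2)⁻¹ • Qmat S3 θorth)) := by
  ext ⟨⟨a, b⟩, ⟨d, e⟩⟩ ⟨w, z⟩
  rw [RV_mul_apply_of_symm u hu0 h1 h2 (iota ⊗ₖ iota) (w, z) (fun p => iota p w)
    (fun p => iota p z) (iota_symm w) (iota_symm z) fun _ => rfl]
  simp only [Matrix.mul_smul, Matrix.mul_add, Matrix.mul_sub, Matrix.mul_one, Matrix.smul_apply,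
    Matrix.add_apply, Matrix.sub_apply, smul_eq_mul, mul_Pmat_apply, mul_Qmat_apply, kroneckerMap_apply,
    Prod.swap_prod_mk, sum_iota_mul_iota_wneg, invForm_iota]
  ring
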